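/- arXiv:2209.00705 — 5 statements merged into one kernel-verified Lean document; each statement's English description precedes it below -/
import Mathlib

section
/- Let G be a finite group and p a prime. Then |CD(G)| = |L(G)| - 1 if and only if G is isomorphic to the cyclic group Z_p of prime order for some prime p, or G is isomorphic to the quaternion group Q_8 of order 8. -/
/-- The Chermak-Delgado measure of a subgroup `H` of `G`: `m_G(H) = |H| * |C_G(H)|`. -/
noncomputable def cdMeasure (G : Type*) [Group G] (H : Subgroup G) : ℕ :=
  Nat.card H * Nat.card (Subgroup.centralizer (H : Set G))

/-- The Chermak-Delgado lattice of `G`: the set of subgroups whose Chermak-Delgado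
measure is maximal among all subgroups of `G`. -/
def cdLattice (G : Type*) [Group G] : Set (Subgroup G) :=
  {H | ∀ K : Subgroup G, cdMeasure G K ≤ cdMeasure G H}

open Subgroup
open scoped commutatorElement

section Measure

variable {G : Type*} [Group G]

theorem cdMeasure_bot : cdMeasure G ⊥ = Nat.card G := by
  have h : centralizer ((⊥ : Subgroup G) : Set G) = ⊤ :=
    centralizer_eq_top_iff_subset.mpr (by simp)
  rw [cdMeasure, h, card_bot, card_top, one_mul]

theorem cdMeasure_top : cdMeasure G ⊤ = Nat.card G * Nat.card (center G) := by
  simp [cdMeasure, centralizer_univ]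

theorem mem_centralizer_zpowers {x g : G} :
    g ∈ centralizer (zpowers x : Set G) ↔ Commute g x := by
  rw [zpowers_eq_closure, centralizer_closure, mem_centralizer_singleton_iff]
  rfl

theorem Commute.of_zpowers_eq {y w g : G} (h : zpowers y = zpowers w) (hg : Commute g w) :
    Commute g y := by
  rw [← mem_centralizer_zpowers] at hg ⊢
  rwa [h]

theorem ne_one_of_orderOf_eq_sq {p : ℕ} [Fact p.Prime] {y : G} (hy : orderOf y = p ^ 2) : y ≠ 1 := by
  rintro rfl
  have := Nat.one_lt_pow two_ne_zero (Fact.out : p.Prime).one_lt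
  rw [orderOf_one] at hy
  omega

theorem cdMeasure_zpowers (x : G) :
    cdMeasure G (zpowers x) = orderOf x * Nat.card (centralizer (zpowers x : Set G)) := by
  simp [cdMeasure, Nat.card_zpowers]

theorem cdMeasure_map {G' : Type*} [Group G'] (e : G ≃* G') (H : Subgroup G) :
    cdMeasure G' (H.map e.toMonoidHom) = cdMeasure G H := by
  have h : centralizer ((H.map e.toMonoidHom : Subgroup G') : Set G') =
      (centralizer (H : Set G)).map e.toMonoidHom := by
    ext g
    obtain ⟨g, rfl⟩ := e.surjective g
    simp [mem_centralizer_iff, ← map_mul]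
  have hc (K : Subgroup G) : Nat.card (K.map e.toMonoidHom) = Nat.card K :=
    card_map_of_injective e.injective
  rw [cdMeasure, cdMeasure, h, hc, hc]

variable [Finite G]

theorem card_cdLattice_of_cdMeasure_eq [Nontrivial G] (c : ℕ) (hlt : Nat.card G < c)
    (hc : ∀ H : Subgroup G, H ≠ ⊥ → cdMeasure G H = c) :
    Nat.card (cdLattice G) = Nat.card (Subgroup G) - 1 := by
  have h : cdLattice G = {⊥}ᶜ := by
    ext H
    rw [Set.mem_compl_singleton_iff]
    refine ⟨?_, fun hH K ↦ ?_⟩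
    · rintro hH rfl
      have := hH ⊤
      rw [hc ⊤ top_ne_bot, cdMeasure_bot] at this
      omega
    · rw [hc H hH]
      by_cases hK : K = ⊥
      · rw [hK, cdMeasure_bot]
        exact hlt.le
      · exact (hc K hK).le
  rw [h, Nat.card_coe_set_eq, Set.ncard_compl, Set.ncard_singleton]

theorem exists_unique_notMem_cdLattice
    (h : Nat.card (cdLattice G) = Nat.card (Subgroup G) - 1) :
    ∃ A : Subgroup G, ∀ H, H ∉ cdLattice G ↔ H = A := by
  have h1 : (cdLattice G)ᶜ.ncard = 1 := by
    have : 0 < Nat.card (Subgroup G) := Nat.card_pos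
    rw [Set.ncard_compl, ← Nat.card_coe_set_eq, h]
    omega
  obtain ⟨A, hA⟩ := Set.ncard_eq_one.mp h1
  exact ⟨A, fun H ↦ by rw [← Set.mem_compl_iff, hA, Set.mem_singleton_iff]⟩

theorem exists_orderOf_eq_not_dvd_index_centralizer {q : ℕ} (hq : q.Prime)
    (hqG : q ∣ Nat.card G) :
    ∃ x : G, orderOf x = q ∧ ¬ q ∣ (centralizer (zpowers x : Set G)).index := by
  have := Fact.mk hq
  let P : Sylow q G := default
  have hP : P.toSubgroup ≠ ⊥ := P.ne_bot_of_dvd_card hqG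
  have : Nontrivial P.toSubgroup := (nontrivial_iff_ne_bot _).mpr hP
  have hZ : Nontrivial (center P.toSubgroup) := P.isPGroup'.center_nontrivial
  have hd : q ∣ Nat.card (center P.toSubgroup) := by
    refine ((P.isPGroup'.to_subgroup (center _)).card_eq_or_dvd).resolve_left ?_
    exact (Finite.one_lt_card).ne'
  obtain ⟨x, hx⟩ := exists_prime_orderOf_dvd_card' q hd
  refine ⟨x.1.1, by rw [orderOf_coe, orderOf_coe, hx],
    fun h ↦ P.not_dvd_index (h.trans (index_dvd_of_le ?_))⟩
  intro g hg
  rw [mem_centralizer_zpowers]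
  exact congrArg Subtype.val (mem_center_iff.mp x.2 ⟨g, hg⟩)

theorem exists_zpowers_cdMeasure_dvd {q : ℕ} (hq : q.Prime) (hqG : q ∣ Nat.card G) :
    ∃ x : G, orderOf x = q ∧ ∀ k, cdMeasure G (zpowers x) = Nat.card G * k → q ∣ k := by
  obtain ⟨x, hx, hi⟩ := exists_orderOf_eq_not_dvd_index_centralizer hq hqG
  refine ⟨x, hx, fun k hk ↦ ?_⟩
  rw [cdMeasure_zpowers, hx, ← card_mul_index (centralizer (zpowers x : Set G)), mul_comm q,
    mul_assoc] at hk
  have := Nat.eq_of_mul_eq_mul_left Nat.card_pos hk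
  exact (hq.dvd_mul.mp (dvd_of_eq this)).resolve_left hi

theorem isPGroup_of_forall_prime_dvd {p : ℕ}
    (h : ∀ q : ℕ, q.Prime → q ∣ Nat.card G → q = p) : IsPGroup p G :=
  IsPGroup.of_card (Nat.eq_prime_pow_of_unique_prime_dvd Nat.card_pos.ne' (h _))

theorem bot_notMem_cdLattice [Nontrivial G] {A : Subgroup G}
    (hA : ∀ H, H ∉ cdLattice G ↔ H = A) : ⊥ ∉ cdLattice G := by
  intro hbot
  have key (q : ℕ) (hq : q.Prime) (hqG : q ∣ Nat.card G) : q = Nat.card A := by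
    obtain ⟨x, hx, hk⟩ := exists_zpowers_cdMeasure_dvd hq hqG
    have hxA : zpowers x = A := (hA _).mp fun hmem ↦ hq.one_lt.ne' <| Nat.dvd_one.mp <| hk 1 <| by
      rw [mul_one, ← cdMeasure_bot]
      exact le_antisymm (hbot _) (hmem _)
    rw [← hxA, Nat.card_zpowers, hx]
  have hp : (Nat.card A).Prime := by
    obtain ⟨q, hq, hqG⟩ := Nat.exists_prime_and_dvd (Finite.one_lt_card (α := G)).ne'
    exact key q hq hqG ▸ hq
  have := Fact.mk hp
  have : Nontrivial (center G) := (isPGroup_of_forall_prime_dvd key).center_nontrivial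
  have h1 := hbot ⊤
  rw [cdMeasure_bot, cdMeasure_top] at h1
  have h2 := Finite.one_lt_card (α := center G)
  have h3 : 0 < Nat.card G := Nat.card_pos
  nlinarith

theorem exists_prime_cdMeasure_eq [Nontrivial G]
    (h : Nat.card (cdLattice G) = Nat.card (Subgroup G) - 1) :
    ∃ p : ℕ, p.Prime ∧ IsPGroup p G ∧ Nat.card (center G) = p ∧
      ∀ H : Subgroup G, H ≠ ⊥ → cdMeasure G H = p * Nat.card G := by
  obtain ⟨A, hA⟩ := exists_unique_notMem_cdLattice h
  have hbot := bot_notMem_cdLattice hA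
  obtain rfl := (hA _).mp hbot
  have hmem (H : Subgroup G) (hH : H ≠ ⊥) : H ∈ cdLattice G := not_not.mp fun h ↦ hH ((hA H).mp h)
  have heq (H : Subgroup G) (hH : H ≠ ⊥) :
      cdMeasure G H = Nat.card G * Nat.card (center G) := by
    rw [← cdMeasure_top]
    exact le_antisymm (hmem ⊤ top_ne_bot _) (hmem H hH _)
  have hZ : Nat.card (center G) ≠ 1 := fun h1 ↦ hbot fun K ↦ by
    rw [cdMeasure_bot]
    by_cases hK : K = ⊥
    · rw [hK, cdMeasure_bot]
    · rw [heq K hK, h1, mul_one]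
  obtain ⟨p, hp, hpZ⟩ := Nat.exists_prime_and_dvd hZ
  have := Fact.mk hp
  obtain ⟨x, hx⟩ := exists_prime_orderOf_dvd_card' p hpZ
  have hx' : orderOf x.1 = p := by rw [orderOf_coe, hx]
  have hcp : Nat.card (center G) = p := by
    have hne : zpowers x.1 ≠ ⊥ := by
      rw [zpowers_ne_bot]
      intro h1
      rw [h1, orderOf_one] at hx'
      exact hp.one_lt.ne hx'
    have h1 := heq _ hne
    have htop : centralizer (zpowers x.1 : Set G) = ⊤ :=
      centralizer_eq_top_iff_subset.mpr (zpowers_le.mpr x.2)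
    rw [cdMeasure_zpowers, hx', htop, card_top, mul_comm] at h1
    exact (Nat.eq_of_mul_eq_mul_left Nat.card_pos h1).symm
  refine ⟨p, hp, isPGroup_of_forall_prime_dvd fun q hq hqG ↦ ?_, hcp, fun H hH ↦ ?_⟩
  · obtain ⟨y, hy, hk⟩ := exists_zpowers_cdMeasure_dvd hq hqG
    refine (Nat.prime_dvd_prime_iff_eq hq hp).mp (hk p ?_)
    rw [heq, hcp]
    rw [zpowers_ne_bot]
    rintro rfl
    rw [orderOf_one] at hy
    exact hq.one_lt.ne hy
  · rw [heq H hH, hcp, mul_comm]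

end Measure

theorem mul_pow_of_mul_eq_mul_mul {G : Type*} [Group G] {x y c : G} (hx : Commute c x)
    (hy : Commute c y) (h : y * x = x * y * c) (n : ℕ) :
    (x * y) ^ n = x ^ n * y ^ n * c ^ n.choose 2 := by
  have hyx (n : ℕ) : y ^ n * x = x * y ^ n * c ^ n := by
    induction n with
    | zero => simp
    | succ n ih =>
      calc y ^ (n + 1) * x = y ^ n * (y * x) := by rw [pow_succ, mul_assoc]
        _ = (y ^ n * x) * y * c := by rw [h]; group
        _ = x * y ^ n * (c ^ n * y) * c := by rw [ih]; group
        _ = x * y ^ (n + 1) * c ^ (n + 1) := by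
          rw [(hy.pow_left n).eq]; simp only [pow_succ, mul_assoc]
  induction n with
  | zero => simp
  | succ n ih =>
    calc (x * y) ^ (n + 1) = x ^ n * y ^ n * (c ^ n.choose 2 * (x * y)) := by
          rw [pow_succ, ih]; simp only [mul_assoc]
      _ = x ^ n * (y ^ n * x) * y * c ^ n.choose 2 := by
          rw [((hx.mul_right hy).pow_left _).eq]; simp only [mul_assoc]
      _ = x ^ n * x * y ^ n * (c ^ n * y) * c ^ n.choose 2 := by
          rw [hyx]; simp only [mul_assoc]
      _ = x ^ (n + 1) * y ^ (n + 1) * (c ^ n * c ^ n.choose 2) := by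
          rw [(hy.pow_left n).eq]; simp only [pow_succ, mul_assoc]
      _ = _ := by rw [← pow_add, Nat.choose_succ_succ' n 1, Nat.choose_one_right]

section ConstantMeasure

variable {G : Type*} [Group G] [Finite G] {p : ℕ} [Fact p.Prime]

theorem mem_center_of_pow_eq_one
    (hm : ∀ H : Subgroup G, H ≠ ⊥ → cdMeasure G H = p * Nat.card G) {x : G} (hx : x ^ p = 1) :
    x ∈ center G := by
  by_cases h1 : x = 1
  · exact h1 ▸ one_mem _
  have h := hm (zpowers x) (zpowers_ne_bot.mpr h1)
  rw [cdMeasure_zpowers, orderOf_eq_prime hx h1] at h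
  have h2 := Nat.eq_of_mul_eq_mul_left (Fact.out : p.Prime).pos h
  have h3 := eq_top_of_card_eq _ h2
  exact centralizer_eq_top_iff_subset.mp h3 (mem_zpowers x)

theorem exists_pow_orderOf_eq_sq (hp : IsPGroup p G)
    (hm : ∀ H : Subgroup G, H ≠ ⊥ → cdMeasure G H = p * Nat.card G) {g : G}
    (hg : g ∉ center G) : ∃ k : ℕ, orderOf (g ^ k) = p ^ 2 := by
  obtain ⟨n, hn⟩ := IsPGroup.iff_orderOf.mp hp g
  have hpp : p.Prime := Fact.out
  have h2 : 2 ≤ n := by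
    by_contra! h
    refine hg (mem_center_of_pow_eq_one hm ?_)
    rw [← orderOf_dvd_iff_pow_eq_one, hn]
    exact (pow_dvd_pow p (by omega : n ≤ 1)).trans (by simp)
  refine ⟨p ^ (n - 2), ?_⟩
  rw [orderOf_pow_of_dvd (pow_ne_zero _ hpp.ne_zero) (hn ▸ pow_dvd_pow p (by omega)), hn,
    Nat.pow_div (by omega) hpp.pos]
  congr 1
  omega

theorem zpowers_eq_of_mem_of_orderOf_eq {y w : G} (h : orderOf w = orderOf y)
    (hw : w ∈ zpowers y) : zpowers w = zpowers y :=
  eq_of_le_of_card_ge (zpowers_le.mpr hw) (by simp [Nat.card_zpowers, h])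

theorem index_centralizer_of_orderOf_eq_sq
    (hm : ∀ H : Subgroup G, H ≠ ⊥ → cdMeasure G H = p * Nat.card G) {y : G}
    (hy : orderOf y = p ^ 2) : (centralizer (zpowers y : Set G)).index = p := by
  have h := hm (zpowers y) (zpowers_ne_bot.mpr (ne_one_of_orderOf_eq_sq hy))
  rw [cdMeasure_zpowers, hy, ← card_mul_index (centralizer (zpowers y : Set G)), sq, mul_assoc] at h
  have h2 := Nat.eq_of_mul_eq_mul_left (Fact.out : p.Prime).pos h
  rw [mul_comm] at h2
  exact (Nat.eq_of_mul_eq_mul_left Nat.card_pos h2).symm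

theorem normal_zpowers_of_orderOf_eq_sq (hp : IsPGroup p G)
    (hm : ∀ H : Subgroup G, H ≠ ⊥ → cdMeasure G H = p * Nat.card G) {y : G}
    (hy : orderOf y = p ^ 2) : (zpowers y).Normal := by
  have hpp : p.Prime := Fact.out
  set C := centralizer (zpowers y : Set G)
  have hle : zpowers y ≤ C := zpowers_le.mpr (mem_centralizer_zpowers.mpr (Commute.refl y))
  have hCbot : C ≠ ⊥ := fun h ↦
    ne_one_of_orderOf_eq_sq hy (zpowers_eq_bot.mp (le_bot_iff.mp (h ▸ hle)))
  have hCn : C.Normal := by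
    refine normal_of_index_eq_minFac_card ?_
    obtain ⟨n, hn⟩ := IsPGroup.iff_card.mp hp
    have hn0 : n ≠ 0 := by
      rintro rfl
      have := Subgroup.index_dvd_card C
      rw [index_centralizer_of_orderOf_eq_sq hm hy, hn, pow_zero, Nat.dvd_one] at this
      exact hpp.one_lt.ne' this
    rw [index_centralizer_of_orderOf_eq_sq hm hy, hn, hpp.pow_minFac hn0]
  have h1 := hm C hCbot
  rw [← hm (zpowers y) (zpowers_ne_bot.mpr (ne_one_of_orderOf_eq_sq hy)), cdMeasure, cdMeasure,
    mul_comm] at h1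
  have h2 := Nat.eq_of_mul_eq_mul_right Nat.card_pos h1
  have h3 : zpowers y = centralizer (C : Set G) :=
    eq_of_le_of_card_ge (le_centralizer_iff.mp le_rfl) h2.le
  rw [h3]
  infer_instance

theorem zpowers_pow_eq_center (hZ : Nat.card (center G) = p)
    (hm : ∀ H : Subgroup G, H ≠ ⊥ → cdMeasure G H = p * Nat.card G) {w : G}
    (hw : orderOf w = p ^ 2) : zpowers (w ^ p) = center G := by
  have hpp : p.Prime := Fact.out
  refine eq_of_le_of_card_ge (zpowers_le.mpr (mem_center_of_pow_eq_one hm ?_)) ?_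
  · rw [← pow_mul, ← sq, ← hw, pow_orderOf_eq_one]
  · rw [hZ, Nat.card_zpowers, orderOf_pow_of_dvd hpp.ne_zero (hw ▸ dvd_pow_self p two_ne_zero), hw,
      sq, Nat.mul_div_cancel _ hpp.pos]

theorem center_le_zpowers (hZ : Nat.card (center G) = p)
    (hm : ∀ H : Subgroup G, H ≠ ⊥ → cdMeasure G H = p * Nat.card G) {w : G}
    (hw : orderOf w = p ^ 2) : center G ≤ zpowers w :=
  zpowers_pow_eq_center hZ hm hw ▸ zpowers_le.mpr (pow_mem (mem_zpowers w) p)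

theorem exists_zpow_mul_pow_eq_one (hZ : Nat.card (center G) = p)
    (hm : ∀ H : Subgroup G, H ≠ ⊥ → cdMeasure G H = p * Nat.card G) {y w : G}
    (hy : orderOf y = p ^ 2) (hw : orderOf w = p ^ 2) :
    ∃ u ∈ zpowers w, y ^ p * u ^ p = 1 := by
  have h : y ^ p ∈ zpowers (w ^ p) := by
    rw [zpowers_pow_eq_center hZ hm hw, ← zpowers_pow_eq_center hZ hm hy]
    exact mem_zpowers _
  obtain ⟨k, hk⟩ := mem_zpowers_iff.mp h
  refine ⟨w ^ (-k), zpow_mem_zpowers w (-k), ?_⟩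
  rw [← hk, ← zpow_natCast, ← zpow_natCast, ← zpow_mul, ← zpow_mul, ← zpow_add]
  simp [mul_comm]

theorem zpowers_eq_of_mul_pow_eq_one (hZ : Nat.card (center G) = p)
    (hm : ∀ H : Subgroup G, H ≠ ⊥ → cdMeasure G H = p * Nat.card G) {y w u : G}
    (hy : orderOf y = p ^ 2) (hw : orderOf w = p ^ 2) (hu : u ∈ zpowers w)
    (h : (y * u) ^ p = 1) : zpowers y = zpowers w := by
  refine zpowers_eq_of_mem_of_orderOf_eq (hy.trans hw.symm) ?_
  exact (mul_mem_cancel_right hu).mp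
    (center_le_zpowers hZ hm hw (mem_center_of_pow_eq_one hm h))

theorem zpowers_eq_of_commute (hZ : Nat.card (center G) = p)
    (hm : ∀ H : Subgroup G, H ≠ ⊥ → cdMeasure G H = p * Nat.card G) {y w : G}
    (hy : orderOf y = p ^ 2) (hw : orderOf w = p ^ 2) (h : Commute y w) :
    zpowers y = zpowers w := by
  obtain ⟨u, hu, hyu⟩ := exists_zpow_mul_pow_eq_one hZ hm hy hw
  obtain ⟨k, rfl⟩ := mem_zpowers_iff.mp hu
  refine zpowers_eq_of_mul_pow_eq_one hZ hm hy hw hu ?_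
  rw [(h.zpow_right k).mul_pow, hyu]

theorem commutator_pow_eq_one (hp : IsPGroup p G)
    (hm : ∀ H : Subgroup G, H ≠ ⊥ → cdMeasure G H = p * Nat.card G) {y w u : G}
    (hy : orderOf y = p ^ 2) (hw : orderOf w = p ^ 2) (hu : u ∈ zpowers w)
    (h : ¬ Commute y w) : ⁅y, u⁆ ^ p = 1 := by
  have := normal_zpowers_of_orderOf_eq_sq hp hm hy
  have := normal_zpowers_of_orderOf_eq_sq hp hm hw
  obtain ⟨h1, h2⟩ := commutator_le_inf _ _ (commutator_mem_commutator (mem_zpowers y) hu)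
  by_contra hc
  have ho : orderOf ⁅y, u⁆ = p ^ 2 := by
    refine orderOf_eq_prime_pow (n := 1) (by simpa using hc) ?_
    rw [← orderOf_dvd_iff_pow_eq_one, ← hy]
    exact orderOf_dvd_of_mem_zpowers h1
  have e1 := zpowers_eq_of_mem_of_orderOf_eq (ho.trans hy.symm) h1
  have e2 := zpowers_eq_of_mem_of_orderOf_eq (ho.trans hw.symm) h2
  exact h (Commute.of_zpowers_eq (e2.symm.trans e1) (Commute.refl y))

theorem eq_two_of_not_commute (hp : IsPGroup p G) (hZ : Nat.card (center G) = p)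
    (hm : ∀ H : Subgroup G, H ≠ ⊥ → cdMeasure G H = p * Nat.card G) {y w : G}
    (hy : orderOf y = p ^ 2) (hw : orderOf w = p ^ 2) (h : ¬ Commute y w) : p = 2 := by
  have hpp : p.Prime := Fact.out
  by_contra hp2
  obtain ⟨u, hu, hyu⟩ := exists_zpow_mul_pow_eq_one hZ hm hy hw
  have hc : ⁅y, u⁆⁻¹ ^ p = 1 := by
    rw [inv_pow, commutator_pow_eq_one hp hm hy hw hu h, inv_one]
  have hcc (g : G) : Commute ⁅y, u⁆⁻¹ g :=
    (mem_center_iff.mp (mem_center_of_pow_eq_one hm hc) g).symm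
  have hrel : u * y = y * u * ⁅y, u⁆⁻¹ := by
    rw [← (hcc _).eq, commutatorElement_def]
    group
  have hdvd : p ∣ p.choose 2 :=
    hpp.dvd_choose_self two_ne_zero (lt_of_le_of_ne hpp.two_le (Ne.symm hp2))
  have h1 : (y * u) ^ p = 1 := by
    obtain ⟨k, hk⟩ := hdvd
    rw [mul_pow_of_mul_eq_mul_mul (hcc y) (hcc u) hrel, hyu, hk, pow_mul, hc, one_pow, one_mul]
  exact h (Commute.of_zpowers_eq (zpowers_eq_of_mul_pow_eq_one hZ hm hy hw hu h1).symm
    (Commute.refl y))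

theorem exists_not_commute_of_center_ne_top (hp : IsPGroup p G) (hZ : Nat.card (center G) = p)
    (hm : ∀ H : Subgroup G, H ≠ ⊥ → cdMeasure G H = p * Nat.card G) (hG : center G ≠ ⊤) :
    ∃ y w : G, orderOf y = p ^ 2 ∧ orderOf w = p ^ 2 ∧ ¬ Commute y w := by
  have hpp : p.Prime := Fact.out
  obtain ⟨g, hg⟩ : ∃ g, g ∉ center G := by
    by_contra! h
    exact hG ((eq_top_iff' _).mpr h)
  obtain ⟨k, hy⟩ := exists_pow_orderOf_eq_sq hp hm hg
  set y := g ^ k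
  obtain ⟨x, hx⟩ : ∃ x, ¬ Commute x y := by
    by_contra! h
    have h1 : y ∈ center G := mem_center_iff.mpr h
    have h2 := Subgroup.orderOf_dvd_natCard _ h1
    rw [hy, hZ] at h2
    have h3 := Nat.le_of_dvd hpp.pos h2
    have := hpp.one_lt
    nlinarith
  have hxZ : x ∉ center G := fun h ↦ hx (mem_center_iff.mp h y).symm
  obtain ⟨j, hw⟩ := exists_pow_orderOf_eq_sq hp hm hxZ
  exact ⟨y, x ^ j, hy, hw, fun h ↦ hx (Commute.of_zpowers_eq
    (zpowers_eq_of_commute hZ hm hy hw h) (Commute.self_pow x j))⟩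

end ConstantMeasure

section Quaternion

variable {G : Type*} [Group G]

theorem ZMod.pow_val_add {x : G} {n : ℕ} [NeZero n] (hx : x ^ n = 1) (i j : ZMod n) :
    x ^ (i + j).val = x ^ i.val * x ^ j.val := by
  rw [ZMod.val_add, ← pow_add, ← pow_mod_orderOf,
    Nat.mod_mod_of_dvd _ (orderOf_dvd_of_pow_eq_one hx),
    pow_mod_orderOf]

theorem exists_quaternionGroup_hom {y w : G} (hy : y ^ 4 = 1) (hw : w ^ 2 = y ^ 2)
    (hyw : y * w = w * y⁻¹) : ∃ f : QuaternionGroup 2 →* G,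
      (∀ i, f (.a i) = y ^ i.val) ∧ ∀ i, f (.xa i) = w * y ^ i.val := by
  have hadd := ZMod.pow_val_add (n := 2 * 2) hy
  have hsub (i j : ZMod (2 * 2)) : y ^ (i - j).val = (y ^ j.val)⁻¹ * y ^ i.val := by
    rw [eq_inv_mul_iff_mul_eq, ← hadd, add_sub_cancel]
  have hconj (k : ℕ) : y ^ k * w = w * (y ^ k)⁻¹ := by
    have : SemiconjBy w y⁻¹ y := hyw.symm
    rw [← inv_pow]
    exact (this.pow_right k).symm
  let F : QuaternionGroup 2 → G
    | .a i => y ^ i.val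
    | .xa i => w * y ^ i.val
  refine ⟨MonoidHom.mk' F ?_, fun _ ↦ rfl, fun _ ↦ rfl⟩
  rintro (i | i) (j | j)
  · exact hadd i j
  · change w * y ^ (j - i).val = y ^ i.val * (w * y ^ j.val)
    rw [hsub, ← mul_assoc, ← mul_assoc, hconj]
  · change w * y ^ (i + j).val = w * y ^ i.val * y ^ j.val
    rw [hadd, mul_assoc]
  · change y ^ ((2 : ZMod (2 * 2)) + j - i).val = w * y ^ i.val * (w * y ^ j.val)
    rw [hsub, hadd, mul_assoc, ← mul_assoc _ w, hconj]
    have h2 : y ^ (2 : ZMod (2 * 2)).val = w * w := (sq w ▸ hw).symm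
    have hcomm : (y ^ i.val)⁻¹ * (w * w) = (w * w) * (y ^ i.val)⁻¹ := by
      rw [← pow_two w, hw]
      exact (((Commute.refl y).pow_pow _ _).inv_left).eq
    rw [h2, ← mul_assoc, hcomm]
    simp only [mul_assoc]

theorem nonempty_mulEquiv_quaternionGroup [Finite G] (hG : Nat.card G ≤ 8) {y w : G}
    (hy : orderOf y = 4) (hw : w ^ 2 = y ^ 2) (hyw : y * w = w * y⁻¹)
    (hne : w ∉ zpowers y) : Nonempty (G ≃* QuaternionGroup 2) := by
  obtain ⟨f, hfa, hfxa⟩ := exists_quaternionGroup_hom (hy ▸ pow_orderOf_eq_one y) hw hyw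
  have hinj : Function.Injective f := by
    rw [injective_iff_map_eq_one]
    rintro (i | i) h
    · rw [hfa, ← orderOf_dvd_iff_pow_eq_one, hy] at h
      have h0 := Nat.eq_zero_of_dvd_of_lt h (ZMod.val_lt i)
      rw [(ZMod.val_eq_zero i).mp h0, QuaternionGroup.a_zero]
    · rw [hfxa] at h
      exact absurd (eq_inv_of_mul_eq_one_left h ▸ inv_mem (pow_mem (mem_zpowers y) _)) hne
  have hcard : Nat.card (QuaternionGroup 2) = 8 := by
    rw [Nat.card_eq_fintype_card, QuaternionGroup.card]
  have hbij : Function.Bijective f := hinj.bijective_of_nat_card_le (hcard ▸ hG)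
  exact ⟨(MulEquiv.ofBijective f hbij).symm⟩

theorem nonempty_mulEquiv_quaternionGroup_of_cdMeasure_eq [Finite G] (hp : IsPGroup 2 G)
    (hZ : Nat.card (center G) = 2)
    (hm : ∀ H : Subgroup G, H ≠ ⊥ → cdMeasure G H = 2 * Nat.card G) {y w : G}
    (hy : orderOf y = 2 ^ 2) (hw : orderOf w = 2 ^ 2) (h : ¬ Commute y w) :
    Nonempty (G ≃* QuaternionGroup 2) := by
  have huniq {a b : G} (ha : a ^ 2 = 1) (hb : b ^ 2 = 1) (ha1 : a ≠ 1) (hb1 : b ≠ 1) : a = b := by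
    obtain ⟨c, hc⟩ := (Nat.card_eq_two_iff' (1 : center G)).mp hZ
    have ha' := hc.2 ⟨a, mem_center_of_pow_eq_one hm ha⟩ (by simpa [Subtype.ext_iff] using ha1)
    have hb' := hc.2 ⟨b, mem_center_of_pow_eq_one hm hb⟩ (by simpa [Subtype.ext_iff] using hb1)
    exact congrArg Subtype.val (ha'.trans hb'.symm)
  have hsq {a : G} (ha : orderOf a = 2 ^ 2) : (a ^ 2) ^ 2 = 1 ∧ a ^ 2 ≠ 1 := by
    refine ⟨by rw [← pow_mul, ← sq, ← ha, pow_orderOf_eq_one], fun h2 ↦ ?_⟩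
    have := Nat.le_of_dvd two_pos (orderOf_dvd_of_pow_eq_one h2)
    omega
  have hwy : w ^ 2 = y ^ 2 := huniq (hsq hw).1 (hsq hy).1 (hsq hw).2 (hsq hy).2
  have hc : ⁅y, w⁆ = y ^ 2 := huniq (commutator_pow_eq_one hp hm hy hw (mem_zpowers w) h)
    (hsq hy).1 (fun h1 ↦ h (commutatorElement_eq_one_iff_commute.mp h1)) (hsq hy).2
  have hinv : y⁻¹ = y ^ 2 * y := by
    rw [inv_eq_iff_mul_eq_one, ← pow_succ, ← pow_succ', ← (hsq hy).1, ← pow_mul]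
  have hyw : y * w = w * y⁻¹ := by
    have h1 : y * w = y ^ 2 * (w * y) := by
      rw [← hc, commutatorElement_def]
      group
    have h2 := mem_center_iff.mp (mem_center_of_pow_eq_one hm (hsq hy).1) w
    rw [h1, hinv, ← mul_assoc, ← mul_assoc, h2]
  refine nonempty_mulEquiv_quaternionGroup ?_ hy hwy hyw fun hmem ↦ h ?_
  · set K := centralizer (zpowers y : Set G) ⊓ centralizer (zpowers w : Set G)
    have hKZ : K ≤ center G := by
      rintro g ⟨hgy, hgw⟩
      replace hgy := mem_centralizer_zpowers.mp hgy
      replace hgw := mem_centralizer_zpowers.mp hgw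
      by_contra hgZ
      obtain ⟨k, hk⟩ := exists_pow_orderOf_eq_sq hp hm hgZ
      have e1 := zpowers_eq_of_commute hZ hm hk hy (hgy.pow_left k)
      have e2 := zpowers_eq_of_commute hZ hm hk hw (hgw.pow_left k)
      exact h (Commute.of_zpowers_eq (e2.symm.trans e1) (Commute.refl y))
    have hi : K.index ≤ 2 * 2 := by
      refine index_inf_le.trans ?_
      rw [index_centralizer_of_orderOf_eq_sq hm hy, index_centralizer_of_orderOf_eq_sq hm hw]
    have hcard : Nat.card K ≤ 2 := hZ ▸ card_le_of_le hKZ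
    rw [← card_mul_index K]
    exact Nat.mul_le_mul hcard hi
  · exact Commute.of_zpowers_eq (zpowers_eq_of_mem_of_orderOf_eq (hw.trans hy.symm) hmem)
      (Commute.refl y)

theorem cdMeasure_quaternionGroup {H : Subgroup (QuaternionGroup 2)} (hH : H ≠ ⊥) :
    cdMeasure (QuaternionGroup 2) H = 16 := by
  have hcard : Nat.card (QuaternionGroup 2) = 8 := by
    rw [Nat.card_eq_fintype_card, QuaternionGroup.card]
  have hZ : Nat.card (center (QuaternionGroup 2)) = 2 := by
    rw [Nat.card_eq_fintype_card]
    decide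
  have hsq : ∀ x y : QuaternionGroup 2, x ^ 2 = 1 → y * x = x * y := by decide
  have hle : H ≤ center _ → centralizer (H : Set (QuaternionGroup 2)) = ⊤ :=
    centralizer_eq_top_iff_subset.mpr
  have hd := card_subgroup_dvd_card H
  rw [hcard] at hd
  obtain ⟨k, hk, hHk⟩ := (Nat.dvd_prime_pow Nat.prime_two (m := 3)).mp hd
  interval_cases k
  · exact absurd (card_eq_one.mp hHk) hH
  · have hHZ : H ≤ center _ := fun x hx ↦ mem_center_iff.mpr fun y ↦ hsq x y <| by
      exact orderOf_dvd_iff_pow_eq_one.mp ((Subgroup.orderOf_dvd_natCard H hx).trans hHk.dvd)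
    rw [cdMeasure, hle hHZ, hHk, card_top, hcard]
    norm_num
  · have : IsMulCommutative H := IsPGroup.isMulCommutative_of_card_eq_prime_sq hHk
    have h1 := card_dvd_of_le (le_centralizer H)
    have h2 := card_subgroup_dvd_card (centralizer (H : Set (QuaternionGroup 2)))
    have h3 : Nat.card (centralizer (H : Set (QuaternionGroup 2))) ≠ 8 := by
      intro h
      have h4 := eq_top_of_card_eq _ (h.trans hcard.symm)
      have h5 := card_le_of_le (centralizer_eq_top_iff_subset.mp h4 : H ≤ center _)
      omega
    rw [hHk] at h1
    rw [hcard] at h2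
    have h4 := Nat.le_of_dvd (by norm_num) h2
    have h5 : 0 < Nat.card (centralizer (H : Set (QuaternionGroup 2))) := Nat.card_pos
    have h6 : Nat.card (centralizer (H : Set (QuaternionGroup 2))) = 4 := by omega
    rw [cdMeasure, hHk, h6]
    norm_num
  · rw [eq_top_of_card_eq H (hHk.trans hcard.symm), cdMeasure_top, hcard, hZ]

end Quaternion

theorem cdMeasure_of_prime_card {G : Type*} [Group G] {p : ℕ} (hp : p.Prime)
    (hG : Nat.card G = p) {H : Subgroup G} (hH : H ≠ ⊥) : cdMeasure G H = p * p := by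
  have := Fact.mk (hG.symm ▸ hp)
  have := Fact.mk hp
  obtain rfl := (eq_bot_or_eq_top_of_prime_card H).resolve_left hH
  have := isCyclic_of_prime_card hG
  have hc : center G = ⊤ := by
    let := IsCyclic.commGroup (α := G)
    exact CommGroup.center_eq_top
  rw [cdMeasure_top, hc, card_top, hG]

/-- A finite group `G` satisfies `|CD(G)| = |L(G)| - 1` if and only if `G ≅ ℤ_p`
for some prime `p`, or `G ≅ Q₈`. -/
theorem cd_eq_sub_one_iff (G : Type*) [Group G] [Finite G] :
    Nat.card (cdLattice G) = Nat.card (Subgroup G) - 1 ↔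
      (∃ p : ℕ, p.Prime ∧ Nonempty (G ≃* Multiplicative (ZMod p))) ∨
        Nonempty (G ≃* QuaternionGroup 2) := by
  constructor
  · intro h
    obtain hG | hG := subsingleton_or_nontrivial G
    · have h0 : Nat.card (cdLattice G) = 0 := by rw [h, Nat.card_unique]
      have : Nonempty (cdLattice G) := ⟨⊥, fun K ↦ by rw [Subsingleton.elim K ⊥]⟩
      exact absurd h0 Nat.card_pos.ne'
    obtain ⟨p, hp, hpG, hZ, hm⟩ := exists_prime_cdMeasure_eq h
    have := Fact.mk hp
    by_cases hc : center G = ⊤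
    · rw [hc, card_top] at hZ
      exact .inl ⟨p, hp, ⟨mulEquivOfPrimeCardEq (p := p) hZ (by simp)⟩⟩
    · obtain ⟨y, w, hy, hw, hyw⟩ := exists_not_commute_of_center_ne_top hpG hZ hm hc
      obtain rfl := eq_two_of_not_commute hpG hZ hm hy hw hyw
      exact .inr (nonempty_mulEquiv_quaternionGroup_of_cdMeasure_eq hpG hZ hm hy hw hyw)
  · rintro (⟨p, hp, ⟨e⟩⟩ | he)
    · have hG : Nat.card G = p := by
        rw [Nat.card_congr e.toEquiv, Nat.card_congr Multiplicative.toAdd, Nat.card_zmod]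
      have : Nontrivial G := Finite.one_lt_card_iff_nontrivial.mp (hG ▸ hp.one_lt)
      refine card_cdLattice_of_cdMeasure_eq (p * p) ?_ fun H hH ↦ cdMeasure_of_prime_card hp hG hH
      rw [hG]
      exact lt_mul_of_one_lt_left hp.pos hp.one_lt
    · obtain ⟨e⟩ := he
      have hG : Nat.card G = 8 := by
        rw [Nat.card_congr e.toEquiv, Nat.card_eq_fintype_card, QuaternionGroup.card]
      have : Nontrivial G := Finite.one_lt_card_iff_nontrivial.mp (by omega)
      refine card_cdLattice_of_cdMeasure_eq 16 (by omega) fun H hH ↦ ?_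
      rw [← cdMeasure_map e]
      exact cdMeasure_quaternionGroup
        ((map_eq_bot_iff_of_injective H (f := e.toMonoidHom) e.injective).not.mpr hH)
end

section
/- Let n ≥ 3 and let Q_{2^n} be the generalized quaternion group of order 2^n. Then |CD(Q_{2^n})| = |L(Q_{2^n})| - 1 if and only if n = 3. -/
section Counting

variable {G : Type*} [Group G] [Finite G]

/-- If the Chermak-Delgado lattice misses exactly the trivial subgroup, it has one element less
than the subgroup lattice. -/
theorem card_cdLattice_of_eq_compl_bot (h : cdLattice G = {⊥}ᶜ) :
    Nat.card (cdLattice G) = Nat.card (Subgroup G) - 1 := by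
  rw [Nat.card_coe_set_eq, h, Set.ncard_compl, Set.ncard_singleton]

/-- If the Chermak-Delgado lattice misses two subgroups, it does not have exactly one element less
than the subgroup lattice. -/
theorem card_cdLattice_ne_of_notMem {H K : Subgroup G} (hHK : H ≠ K)
    (hH : H ∉ cdLattice G) (hK : K ∉ cdLattice G) :
    Nat.card (cdLattice G) ≠ Nat.card (Subgroup G) - 1 := by
  have hsub : ({H, K} : Set (Subgroup G)) ⊆ (cdLattice G)ᶜ := by
    rintro L (rfl | rfl) <;> assumption
  have hle := Set.ncard_le_ncard hsub
  have hadd := Set.ncard_add_ncard_compl (cdLattice G)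
  rw [Set.ncard_pair hHK] at hle
  rw [Nat.card_coe_set_eq]
  omega

end Counting

theorem cdMeasure_le_card_mul_card {G : Type*} [Group G] [Finite G] (H : Subgroup G) :
    cdMeasure G H ≤ Nat.card H * Nat.card G :=
  Nat.mul_le_mul_left _ (Subgroup.card_le_card_group _)

theorem card_mul_card_le_cdMeasure {G : Type*} [Group G] [Finite G] (H : Subgroup G)
    [IsMulCommutative H] : Nat.card H * Nat.card H ≤ cdMeasure G H :=
  Nat.mul_le_mul_left _ (Subgroup.card_le_of_le H.le_centralizer)

namespace QuaternionGroup

theorem notMem_cdLattice_of_card_le_two {m : ℕ} (hm : 2 < m)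
    {H : Subgroup (QuaternionGroup m)} (hH : Nat.card H ≤ 2) :
    H ∉ cdLattice (QuaternionGroup m) := by
  have : NeZero m := ⟨by omega⟩
  intro h
  have hcyc := card_mul_card_le_cdMeasure (Subgroup.zpowers (a 1 : QuaternionGroup m))
  rw [Nat.card_zpowers, orderOf_a_one] at hcyc
  have hle := cdMeasure_le_card_mul_card H
  rw [Nat.card_eq_fintype_card (α := QuaternionGroup m), card] at hle
  have := h (Subgroup.zpowers (a 1))
  nlinarith

theorem mem_center_two_iff (g : QuaternionGroup 2) :
    g ∈ Subgroup.center (QuaternionGroup 2) ↔ g ∈ Subgroup.zpowers (a 2 : QuaternionGroup 2) := by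
  rw [Subgroup.mem_center_iff, mem_zpowers_iff_mem_range_orderOf,
    show orderOf (a 2 : QuaternionGroup 2) = 2 from
      orderOf_eq_prime (by decide) (by decide)]
  revert g
  decide

theorem center_two : Subgroup.center (QuaternionGroup 2) = Subgroup.zpowers (a 2) :=
  Subgroup.ext mem_center_two_iff

theorem card_center_two : Nat.card (Subgroup.center (QuaternionGroup 2)) = 2 := by
  rw [center_two, Nat.card_zpowers]
  exact orderOf_eq_prime (by decide) (by decide)

theorem center_two_le {H : Subgroup (QuaternionGroup 2)} (hH : H ≠ ⊥) :
    Subgroup.center (QuaternionGroup 2) ≤ H := by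
  obtain ⟨h, h1⟩ := H.ne_bot_iff_exists_ne_one.mp hH
  have key : ∀ g : QuaternionGroup 2, g ≠ 1 → a 2 = g ∨ a 2 = g ^ 2 := by decide
  rw [center_two, Subgroup.zpowers_le]
  rcases key h (by simpa using h1) with h2 | h2 <;> rw [h2]
  · exact h.2
  · exact pow_mem h.2 2

theorem card_two : Nat.card (QuaternionGroup 2) = 8 := by
  rw [Nat.card_eq_fintype_card, card]

theorem cdMeasure_two_of_ne_bot {H : Subgroup (QuaternionGroup 2)} (hH : H ≠ ⊥) :
    cdMeasure (QuaternionGroup 2) H = 16 := by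
  have hdvd : ∀ K : Subgroup (QuaternionGroup 2), ∃ k ≤ 3, Nat.card K = 2 ^ k := fun K =>
    (Nat.dvd_prime_pow Nat.prime_two).mp (K.card_subgroup_dvd_card.trans card_two.dvd)
  have hle := center_two_le hH
  obtain ⟨k, hk, hcard⟩ := hdvd H
  rw [cdMeasure, hcard]
  interval_cases k
  · exact absurd (Subgroup.card_eq_one.mp hcard) hH
  · have hHZ : Subgroup.center _ = H :=
      Subgroup.eq_of_le_of_card_ge hle (by rw [hcard, card_center_two, pow_one])
    rw [Subgroup.centralizer_eq_top_iff_subset.mpr (by rw [hHZ]), Subgroup.card_top, card_two]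
    rfl
  · have : IsMulCommutative H := IsPGroup.isMulCommutative_of_card_eq_prime_sq (p := 2) hcard
    have hge := Subgroup.card_le_of_le H.le_centralizer
    obtain ⟨j, hj, hcard'⟩ := hdvd (Subgroup.centralizer (H : Set (QuaternionGroup 2)))
    rw [hcard, hcard'] at hge
    rw [hcard']
    interval_cases j
    · omega
    · omega
    · rfl
    · have htop := Subgroup.eq_top_of_card_eq _ (hcard'.trans card_two.symm)
      have := Subgroup.card_le_of_le (Subgroup.centralizer_eq_top_iff_subset.mp htop)
      rw [hcard, card_center_two] at this
      omega
  · rw [Subgroup.eq_top_of_card_eq _ (hcard.trans card_two.symm), Subgroup.coe_top,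
      Subgroup.centralizer_univ, card_center_two]
    rfl

theorem cdLattice_two : cdLattice (QuaternionGroup 2) = {⊥}ᶜ := by
  have hbot : cdMeasure (QuaternionGroup 2) ⊥ ≤ 8 := by
    simpa [card_two, -Nat.card_eq_fintype_card] using
      cdMeasure_le_card_mul_card (⊥ : Subgroup (QuaternionGroup 2))
  ext H
  simp only [Set.mem_compl_iff, Set.mem_singleton_iff]
  constructor
  · rintro h rfl
    have := h ⊤
    rw [cdMeasure_two_of_ne_bot top_ne_bot] at this
    omega
  · intro hH K
    rw [cdMeasure_two_of_ne_bot hH]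
    by_cases hK : K = ⊥
    · subst hK; omega
    · exact (cdMeasure_two_of_ne_bot hK).le

end QuaternionGroup

/-- For `n ≥ 3`, the generalized quaternion group `Q_{2^n}` (realized as
`QuaternionGroup (2^(n-2))`, which has order `2^n`) satisfies
`|CD(Q_{2^n})| = |L(Q_{2^n})| - 1` if and only if `n = 3`. -/
theorem quaternion_cd_eq_sub_one_iff (n : ℕ) (hn : 3 ≤ n) :
    Nat.card (cdLattice (QuaternionGroup (2 ^ (n - 2)))) =
      Nat.card (Subgroup (QuaternionGroup (2 ^ (n - 2)))) - 1 ↔ n = 3 := by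
  constructor
  · intro h
    by_contra hne
    have hm : 2 < 2 ^ (n - 2) :=
      calc 2 < 2 ^ 2 := by norm_num
        _ ≤ 2 ^ (n - 2) := Nat.pow_le_pow_right two_pos (by omega)
    generalize 2 ^ (n - 2) = m at h hm
    have : NeZero m := ⟨by omega⟩
    have hcard :
        Nat.card (Subgroup.zpowers (QuaternionGroup.xa 0 ^ 2 : QuaternionGroup m)) = 2 := by
      rw [Nat.card_zpowers, orderOf_pow, QuaternionGroup.orderOf_xa]
      rfl
    refine card_cdLattice_ne_of_notMem (H := ⊥) (K := Subgroup.zpowers (QuaternionGroup.xa 0 ^ 2))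
      ?_ (QuaternionGroup.notMem_cdLattice_of_card_le_two hm (by simp))
      (QuaternionGroup.notMem_cdLattice_of_card_le_two hm hcard.le) h
    intro heq
    rw [← heq, Subgroup.card_bot] at hcard
    omega
  · rintro rfl
    exact card_cdLattice_of_eq_compl_bot QuaternionGroup.cdLattice_two
end

section
/- Let n ≥ 3 and let Q_{2^n} be the generalized quaternion group of order 2^n. Then the maximal Chermak-Delgado measure m*(Q_{2^n}) = max{ |H|·|C(H)| : H ≤ Q_{2^n} } equals 2^{2n-2}. -/
theorem ZMod.eq_zero_or_eq_of_add_self_eq_zero {m : ℕ} [NeZero m] {j : ZMod (2 * m)}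
    (h : j + j = 0) : j = 0 ∨ j = (m : ZMod (2 * m)) := by
  have hlt : j.val < 2 * m := j.val_lt
  have hdvd : 2 * m ∣ 2 * j.val := by
    rw [← ZMod.natCast_eq_zero_iff]
    push_cast
    rw [ZMod.natCast_zmod_val]
    linear_combination h
  obtain ⟨c, hc⟩ := Nat.dvd_of_mul_dvd_mul_left two_pos hdvd
  have hm : 0 < m := Nat.pos_of_neZero m
  have hc2 : c < 2 := by
    by_contra! hge
    nlinarith
  rw [← ZMod.natCast_zmod_val j, hc]
  interval_cases c <;> simp

namespace QuaternionGroup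

variable {m : ℕ} [NeZero m]

theorem eq_of_commute_a_xa {i j : ZMod (2 * m)} (h : Commute (a j) (xa i)) :
    j = 0 ∨ j = (m : ZMod (2 * m)) := by
  have h' := h.eq
  rw [a_mul_xa, xa_mul_a, xa.injEq] at h'
  apply ZMod.eq_zero_or_eq_of_add_self_eq_zero
  linear_combination -h'

theorem eq_of_commute_xa_xa {i j : ZMod (2 * m)} (h : Commute (xa j) (xa i)) :
    j = i ∨ j = i + (m : ZMod (2 * m)) := by
  have h' := h.eq
  rw [xa_mul_xa, xa_mul_xa, a.injEq] at h'
  have := ZMod.eq_zero_or_eq_of_add_self_eq_zero (m := m) (j := j - i)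
    (by linear_combination -h')
  rwa [sub_eq_zero, sub_eq_iff_eq_add'] at this

theorem ncard_le_four_of_commute_xa {s : Set (QuaternionGroup m)} {i : ZMod (2 * m)}
    (hs : ∀ g ∈ s, Commute g (xa i)) : s.ncard ≤ 4 := by
  classical
  let t : Finset (QuaternionGroup m) := {a 0, a m, xa i, xa (i + (m : ZMod (2 * m)))}
  have hst : s ⊆ t := by
    rintro (j | j) hj
    · rcases eq_of_commute_a_xa (hs _ hj) with rfl | rfl <;> simp [t]
    · rcases eq_of_commute_xa_xa (hs _ hj) with rfl | rfl <;> simp [t]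
  calc s.ncard ≤ (t : Set (QuaternionGroup m)).ncard := Set.ncard_le_ncard hst
    _ = t.card := Set.ncard_coe_finset t
    _ ≤ 4 := Finset.card_le_four

theorem ncard_le_two_of_commute_xa {s : Set (QuaternionGroup m)} {i : ZMod (2 * m)}
    (hs : ∀ g ∈ s, Commute g (xa i)) (hxa : ∀ j, xa j ∉ s) : s.ncard ≤ 2 := by
  classical
  let t : Finset (QuaternionGroup m) := {a 0, a m}
  have hst : s ⊆ t := by
    rintro (j | j) hj
    · rcases eq_of_commute_a_xa (hs _ hj) with rfl | rfl <;> simp [t]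
    · exact absurd hj (hxa j)
  calc s.ncard ≤ (t : Set (QuaternionGroup m)).ncard := Set.ncard_le_ncard hst
    _ = t.card := Set.ncard_coe_finset t
    _ ≤ 2 := Finset.card_le_two

theorem ncard_le_of_forall_xa_notMem {s : Set (QuaternionGroup m)} (hxa : ∀ j, xa j ∉ s) :
    s.ncard ≤ 2 * m := by
  have hst : s ⊆ Set.range a := by
    rintro (j | j) hj
    · exact ⟨j, rfl⟩
    · exact absurd hj (hxa j)
  calc s.ncard ≤ (Set.range (a : ZMod (2 * m) → QuaternionGroup m)).ncard :=
        Set.ncard_le_ncard hst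
    _ ≤ Nat.card (ZMod (2 * m)) := Finite.card_range_le _
    _ = 2 * m := Nat.card_zmod _

theorem ncard_mul_ncard_le_of_xa_mem (hm : 2 ≤ m) {s t : Set (QuaternionGroup m)}
    (hst : ∀ g ∈ s, ∀ h ∈ t, Commute g h) {i : ZMod (2 * m)} (hi : xa i ∈ s) :
    s.ncard * t.ncard ≤ (2 * m) ^ 2 := by
  have ht : ∀ h ∈ t, Commute h (xa i) := fun h hh => (hst _ hi h hh).symm
  by_cases hxa : ∃ j, xa j ∈ t
  · obtain ⟨j, hj⟩ := hxa
    have hs4 := ncard_le_four_of_commute_xa fun g hg => hst g hg _ hj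
    have ht4 := ncard_le_four_of_commute_xa ht
    nlinarith [Nat.mul_le_mul hs4 ht4]
  · have ht2 := ncard_le_two_of_commute_xa ht (not_exists.mp hxa)
    have hs : s.ncard ≤ 4 * m := by
      rw [← card, ← Nat.card_eq_fintype_card]
      exact Set.ncard_le_card s
    nlinarith [Nat.mul_le_mul hs ht2]

theorem ncard_mul_ncard_le (hm : 2 ≤ m) {s t : Set (QuaternionGroup m)}
    (hst : ∀ g ∈ s, ∀ h ∈ t, Commute g h) : s.ncard * t.ncard ≤ (2 * m) ^ 2 := by
  by_cases hs : ∃ i, xa i ∈ s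
  · obtain ⟨i, hi⟩ := hs
    exact ncard_mul_ncard_le_of_xa_mem hm hst hi
  by_cases ht : ∃ i, xa i ∈ t
  · obtain ⟨i, hi⟩ := ht
    rw [mul_comm]
    exact ncard_mul_ncard_le_of_xa_mem hm (fun g hg h hh => (hst h hh g hg).symm) hi
  rw [sq]
  exact Nat.mul_le_mul (ncard_le_of_forall_xa_notMem (not_exists.mp hs))
    (ncard_le_of_forall_xa_notMem (not_exists.mp ht))

theorem cdMeasure_le (hm : 2 ≤ m) (H : Subgroup (QuaternionGroup m)) :
    cdMeasure (QuaternionGroup m) H ≤ (2 * m) ^ 2 :=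
  ncard_mul_ncard_le (s := H) (t := Subgroup.centralizer (H : Set (QuaternionGroup m))) hm
    fun g hg _ hh => Subgroup.mem_centralizer_iff.mp hh g hg

theorem le_cdMeasure_zpowers_a_one :
    (2 * m) ^ 2 ≤ cdMeasure (QuaternionGroup m) (Subgroup.zpowers (a 1)) := by
  have hcard : Nat.card (Subgroup.zpowers (a 1 : QuaternionGroup m)) = 2 * m := by
    rw [Nat.card_zpowers, orderOf_a_one]
  have hle : Subgroup.zpowers (a 1 : QuaternionGroup m) ≤
      Subgroup.centralizer (Subgroup.zpowers (a 1 : QuaternionGroup m)) :=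
    Subgroup.le_centralizer _
  have hle' := Subgroup.card_le_of_le hle
  rw [hcard] at hle'
  rw [cdMeasure, hcard, sq]
  exact Nat.mul_le_mul_left _ hle'

end QuaternionGroup

/-- For `n ≥ 3`, the maximal Chermak-Delgado measure of the generalized quaternion
group `Q_{2^n}` (realized as `QuaternionGroup (2^(n-2))`, which has order `2^n`)
equals `2^(2n-2)`. -/
theorem quaternion_max_cdMeasure (n : ℕ) (hn : 3 ≤ n) :
    IsGreatest (Set.range (cdMeasure (QuaternionGroup (2 ^ (n - 2))))) (2 ^ (2 * n - 2)) := by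
  have hm : 2 ≤ 2 ^ (n - 2) := Nat.le_self_pow (by omega) 2
  have hpow : 2 ^ (2 * n - 2) = (2 * 2 ^ (n - 2)) ^ 2 := by
    rw [← pow_succ', ← pow_mul]
    congr 1
    omega
  rw [hpow]
  refine ⟨⟨Subgroup.zpowers (QuaternionGroup.a 1), ?_⟩, ?_⟩
  · exact le_antisymm (QuaternionGroup.cdMeasure_le hm _)
      QuaternionGroup.le_cdMeasure_zpowers_a_one
  · rintro _ ⟨H, rfl⟩
    exact QuaternionGroup.cdMeasure_le hm H
end

section
/- Let n ≥ 4 and let Q_{2^n} = ⟨a, b⟩ be the generalized quaternion group of order 2^n. Then the Chermak-Delgado lattice of Q_{2^n} is the singleton {⟨a⟩}, i.e., CD(Q_{2^n}) consists exactly of the cyclic subgroup ⟨a⟩ of order 2^{n-1}. -/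
theorem ZMod.eq_zero_or_eq_natCast_of_two_mul_eq_zero {m : ℕ} [NeZero m] {i : ZMod (2 * m)}
    (h : 2 * i = 0) : i = 0 ∨ i = (m : ZMod (2 * m)) := by
  have hm : 0 < m := NeZero.pos m
  have hlt : i.val < 2 * m := ZMod.val_lt i
  rw [← ZMod.natCast_zmod_val i] at h ⊢
  have h' : ((2 * i.val : ℕ) : ZMod (2 * m)) = 0 := by exact_mod_cast h
  rw [ZMod.natCast_eq_zero_iff] at h'
  obtain ⟨c, hc⟩ := Nat.dvd_of_mul_dvd_mul_left two_pos h'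
  have hc2 : c < 2 := by
    by_contra! hc2
    nlinarith
  interval_cases c
  · left; simp [hc]
  · right; simp [hc]

namespace QuaternionGroup

variable {m : ℕ}

theorem commute_xa_a_iff {i j : ZMod (2 * m)} : Commute (xa j) (a i) ↔ 2 * i = 0 := by
  rw [Commute, SemiconjBy, xa_mul_a, a_mul_xa, xa.injEq]
  constructor <;> intro h <;> linear_combination h

theorem two_mul_sub_eq_zero_of_commute_xa_xa {i j : ZMod (2 * m)} (h : Commute (xa j) (xa i)) :
    2 * (i - j) = 0 := by
  rw [Commute, SemiconjBy, xa_mul_xa, xa_mul_xa, a.injEq] at h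
  linear_combination h

theorem nat_card_zpowers_a_one :
    Nat.card (Subgroup.zpowers (a (1 : ZMod (2 * m)))) = 2 * m := by
  rw [Nat.card_zpowers, orderOf_a_one]

variable [NeZero m]

theorem mem_zpowers_a_one (i : ZMod (2 * m)) : a i ∈ Subgroup.zpowers (a (1 : ZMod (2 * m))) := by
  rw [← ZMod.natCast_zmod_val i, ← a_one_pow]
  exact Subgroup.npow_mem_zpowers _ _

theorem centralizer_zpowers_a_one (hm : 2 ≤ m) :
    Subgroup.centralizer (Subgroup.zpowers (a (1 : ZMod (2 * m))) : Set (QuaternionGroup m)) =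
      Subgroup.zpowers (a 1) := by
  apply le_antisymm
  · rintro (i | i) hi
    · exact mem_zpowers_a_one i
    · have h : Commute (a 1) (xa i) := hi (a 1) (Subgroup.mem_zpowers _)
      have h2 : ((2 : ℕ) : ZMod (2 * m)) = 0 := by simpa using commute_xa_a_iff.1 h.symm
      have := Nat.le_of_dvd two_pos ((ZMod.natCast_eq_zero_iff _ _).1 h2)
      omega
  · exact Subgroup.le_centralizer _

theorem nat_card_le_four_of_commute_xa {H : Subgroup (QuaternionGroup m)} {j : ZMod (2 * m)}
    (h : ∀ g ∈ H, Commute (xa j) g) : Nat.card H ≤ 4 := by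
  have hsub : (H : Set (QuaternionGroup m)) ⊆ {a 0, a m, xa j, xa (j + (m : ZMod (2 * m)))} := by
    rintro (i | i) hi
    · rcases ZMod.eq_zero_or_eq_natCast_of_two_mul_eq_zero (commute_xa_a_iff.1 (h _ hi))
        with rfl | rfl <;> simp
    · rcases ZMod.eq_zero_or_eq_natCast_of_two_mul_eq_zero
        (two_mul_sub_eq_zero_of_commute_xa_xa (h _ hi)) with h0 | h0
      · simp [sub_eq_zero.1 h0]
      · simp [sub_eq_iff_eq_add'.1 h0]
  calc Nat.card H = (H : Set (QuaternionGroup m)).ncard := rfl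
    _ ≤ _ := Set.ncard_le_ncard hsub (Set.toFinite _)
    _ ≤ 4 := by
      classical
      have := Finset.card_le_four (a := a 0) (b := a m) (c := xa j) (d := xa (j + (m : ZMod (2 * m))))
      rw [← Set.ncard_coe_finset] at this
      simpa using this

theorem nat_card_le_two_of_commute_xa {H : Subgroup (QuaternionGroup m)} {j : ZMod (2 * m)}
    (h : ∀ g ∈ H, Commute (xa j) g) (hH : ∀ i, xa i ∉ H) : Nat.card H ≤ 2 := by
  have hsub : (H : Set (QuaternionGroup m)) ⊆ {a 0, a m} := by
    rintro (i | i) hi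
    · rcases ZMod.eq_zero_or_eq_natCast_of_two_mul_eq_zero (commute_xa_a_iff.1 (h _ hi))
        with rfl | rfl <;> simp
    · exact absurd hi (hH i)
  calc Nat.card H = (H : Set (QuaternionGroup m)).ncard := rfl
    _ ≤ _ := Set.ncard_le_ncard hsub (Set.toFinite _)
    _ ≤ 2 := (Set.ncard_insert_le _ _).trans (by simp)

theorem nat_card_mul_nat_card_le_of_xa_mem (hm : 2 ≤ m) {H K : Subgroup (QuaternionGroup m)}
    (hHK : ∀ h ∈ H, ∀ k ∈ K, Commute h k) {j : ZMod (2 * m)} (hj : xa j ∈ H) :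
    Nat.card H * Nat.card K ≤ 8 * m := by
  by_cases hK : ∃ i, xa i ∈ K
  · obtain ⟨i, hi⟩ := hK
    have h1 := nat_card_le_four_of_commute_xa (hHK _ hj)
    have h2 : Nat.card H ≤ 4 := nat_card_le_four_of_commute_xa fun h hh => (hHK h hh _ hi).symm
    calc Nat.card H * Nat.card K ≤ 4 * 4 := Nat.mul_le_mul h2 h1
      _ ≤ 8 * m := by omega
  · have h1 := nat_card_le_two_of_commute_xa (hHK _ hj) (not_exists.1 hK)
    have h2 : Nat.card H ≤ 4 * m := by
      simpa [Nat.card_eq_fintype_card, card] using Subgroup.card_le_card_group H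
    calc Nat.card H * Nat.card K ≤ 4 * m * 2 := Nat.mul_le_mul h2 h1
      _ = 8 * m := by ring

theorem le_zpowers_a_one_of_xa_notMem {H : Subgroup (QuaternionGroup m)} (hH : ∀ i, xa i ∉ H) :
    H ≤ Subgroup.zpowers (a 1) := by
  rintro (i | i) hi
  · exact mem_zpowers_a_one i
  · exact absurd hi (hH i)

theorem cdMeasure_zpowers_a_one (hm : 2 ≤ m) :
    cdMeasure (QuaternionGroup m) (Subgroup.zpowers (a 1)) = 2 * m * (2 * m) := by
  rw [cdMeasure, centralizer_zpowers_a_one hm, nat_card_zpowers_a_one]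

theorem cdMeasure_lt_of_ne_zpowers_a_one (hm : 3 ≤ m) {H : Subgroup (QuaternionGroup m)}
    (hne : H ≠ Subgroup.zpowers (a 1)) :
    cdMeasure (QuaternionGroup m) H < 2 * m * (2 * m) := by
  have hcomm : ∀ h ∈ H, ∀ k ∈ Subgroup.centralizer (H : Set (QuaternionGroup m)),
      Commute h k := fun h hh k hk => hk h hh
  have hlt : 8 * m < 2 * m * (2 * m) := by nlinarith
  by_cases hH : ∃ j, xa j ∈ H
  · obtain ⟨j, hj⟩ := hH
    exact (nat_card_mul_nat_card_le_of_xa_mem (by omega) hcomm hj).trans_lt hlt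
  by_cases hC : ∃ j, xa j ∈ Subgroup.centralizer (H : Set (QuaternionGroup m))
  · obtain ⟨j, hj⟩ := hC
    rw [cdMeasure, mul_comm]
    exact (nat_card_mul_nat_card_le_of_xa_mem (by omega)
      (fun k hk h hh => (hcomm h hh k hk).symm) hj).trans_lt hlt
  have hHle := le_zpowers_a_one_of_xa_notMem (not_exists.1 hH)
  have hCcard := Subgroup.card_le_of_le (le_zpowers_a_one_of_xa_notMem (not_exists.1 hC))
  have hHcard : Nat.card H < 2 * m := by
    rw [← nat_card_zpowers_a_one]
    by_contra! hge
    exact hne (Subgroup.eq_of_le_of_card_ge hHle hge)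
  rw [nat_card_zpowers_a_one] at hCcard
  exact Nat.mul_lt_mul_of_lt_of_le hHcard hCcard (by omega)

theorem cdLattice_eq_singleton (hm : 3 ≤ m) :
    cdLattice (QuaternionGroup m) = {Subgroup.zpowers (a 1)} := by
  have hA := cdMeasure_zpowers_a_one (m := m) (by omega)
  ext H
  rw [Set.mem_singleton_iff]
  constructor
  · intro hH
    by_contra hne
    exact (cdMeasure_lt_of_ne_zpowers_a_one hm hne).not_ge (hA ▸ hH _)
  · rintro rfl K
    by_cases hK : K = Subgroup.zpowers (a 1)
    · rw [hK]
    · exact hA ▸ (cdMeasure_lt_of_ne_zpowers_a_one hm hK).le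

end QuaternionGroup

/-- For `n ≥ 4`, the Chermak-Delgado lattice of the generalized quaternion group
`Q_{2^n}` (realized as `QuaternionGroup (2^(n-2))`, which has order `2^n`) is the
singleton `{⟨a⟩}`, where `⟨a⟩` is the cyclic subgroup generated by `a`, of order
`2^(n-1)`. -/
theorem cd_quaternion_singleton (n : ℕ) (hn : 4 ≤ n) :
    cdLattice (QuaternionGroup (2 ^ (n - 2))) =
      {Subgroup.zpowers (QuaternionGroup.a (1 : ZMod (2 * 2 ^ (n - 2))))} ∧
    Nat.card (Subgroup.zpowers (QuaternionGroup.a (1 : ZMod (2 * 2 ^ (n - 2))))) =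
      2 ^ (n - 1) := by
  have hm : 3 ≤ 2 ^ (n - 2) :=
    le_trans (by norm_num) (Nat.pow_le_pow_right two_pos (show 2 ≤ n - 2 by omega))
  refine ⟨QuaternionGroup.cdLattice_eq_singleton hm, ?_⟩
  rw [QuaternionGroup.nat_card_zpowers_a_one, ← pow_succ']
  congr 1
  omega
end

section
/- Let p < q be primes and let G be a non-abelian group of order pq. Then the Chermak-Delgado lattice CD(G) consists exactly of the unique Sylow q-subgroup of G, i.e., CD(G) = {Q} where Q is the unique subgroup of G of order q. -/
namespace Subgroup

variable {G : Type*} [Group G] {r s : ℕ}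

/-- A non-abelian group whose order is a product of two primes has trivial center. -/
theorem center_eq_bot_of_card_eq_mul_prime (hr : r.Prime) (hs : s.Prime)
    (hG : Nat.card G = r * s) (hna : ¬ ∀ a b : G, a * b = b * a) : center G = ⊥ := by
  have hnc : ¬ IsCyclic (G ⧸ center G) := fun _ =>
    hna (isMulCommutative_iff.mp
      ((QuotientGroup.mk' (center G)).isMulCommutative_of_isCyclic_of_ker_le_center (by simp)))
  have hmul := (center G).card_mul_index
  have hidx : ∀ {t : ℕ}, t.Prime → (center G).index ≠ t := fun {t} ht h =>
    have := Fact.mk ht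
    hnc (isCyclic_of_prime_card (p := t) (by rwa [← index_eq_card]))
  have hone : (center G).index ≠ 1 := fun h =>
    hnc (have : Subsingleton (G ⧸ center G) :=
      (Nat.card_eq_one_iff_unique.mp (by rwa [← index_eq_card])).1; inferInstance)
  rw [hG] at hmul
  obtain ⟨a, b, ha, hb, hab⟩ := (Nat.dvd_mul (k := (center G).index)).mp (Dvd.intro_left _ hmul)
  rcases (Nat.dvd_prime hr).mp ha with rfl | rfl <;> rcases (Nat.dvd_prime hs).mp hb with rfl | rfl
  · exact absurd (by simpa using hab.symm) hone
  · exact absurd (by simpa using hab.symm) (hidx hs)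
  · exact absurd (by simpa using hab.symm) (hidx hr)
  · rw [← hab] at hmul
    exact card_eq_one.mp
      (Nat.eq_of_mul_eq_mul_right (Nat.mul_pos hr.pos hs.pos) (by simpa using hmul))

/-- In a centerless group of order `r * s` with `r`, `s` prime, a subgroup of order `r` has
centralizer of order `r`. -/
theorem card_centralizer_of_card_eq_prime [Finite G] (hr : r.Prime) (hs : s.Prime)
    (hG : Nat.card G = r * s) (hZ : center G = ⊥) {H : Subgroup G} (hH : Nat.card H = r) :
    Nat.card (centralizer (H : Set G)) = r := by
  have := Fact.mk hr
  have : IsCyclic H := isCyclic_of_prime_card hH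
  have hle : H ≤ centralizer (H : Set G) := le_centralizer H
  obtain ⟨d, hd⟩ := card_dvd_of_le hle
  have hdvd := card_subgroup_dvd_card (centralizer (H : Set G))
  rw [hH] at hd
  rw [hd, hG] at hdvd
  rcases (Nat.dvd_prime hs).mp (Nat.dvd_of_mul_dvd_mul_left hr.pos hdvd) with rfl | rfl
  · simpa using hd
  · have htop : centralizer (H : Set G) = ⊤ := eq_top_of_card_eq _ (hd.trans hG.symm)
    have hbot : H ≤ ⊥ := hZ ▸ centralizer_eq_top_iff_subset.mp htop
    rw [le_bot_iff.mp hbot, card_bot] at hH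
    exact absurd hH.symm hr.ne_one

/-- A subgroup of prime order larger than the index of `H` is contained in `H`. -/
theorem le_of_index_lt_card_prime [Finite G] {H K : Subgroup G} (hs : s.Prime) (hK : Nat.card K = s)
    (hlt : H.index < s) : K ≤ H := by
  have hdvd : H.relIndex K ∣ s := hK ▸ relIndex_dvd_card H K
  have hle : H.relIndex K ≤ H.index :=
    relIndex_top_right H ▸ relIndex_le_of_le_right le_top (by simpa using index_ne_zero_of_finite)
  rcases (Nat.dvd_prime hs).mp hdvd with h | h
  · exact relIndex_eq_one.mp h
  · exact absurd hlt (not_lt.mpr (h ▸ hle))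

end Subgroup

/-- The Chermak-Delgado measure in a centerless group of order `p * q`, with `p`, `q` prime. -/
theorem cdMeasure_eq_or {G : Type*} [Group G] [Finite G] {p q : ℕ} (hp : p.Prime)
    (hq : q.Prime) (hG : Nat.card G = p * q) (hZ : Subgroup.center G = ⊥) (K : Subgroup G) :
    cdMeasure G K = p * q ∨ cdMeasure G K = p * p ∨ Nat.card K = q := by
  obtain ⟨a, b, ha, hb, hab⟩ := Nat.dvd_mul.mp (hG ▸ K.card_subgroup_dvd_card)
  rcases (Nat.dvd_prime hp).mp ha with rfl | rfl <;> rcases (Nat.dvd_prime hq).mp hb with rfl | rfl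
  · have hK : K = ⊥ := Subgroup.card_eq_one.mp (by simpa using hab.symm)
    left
    have hC : Subgroup.centralizer ((⊥ : Subgroup G) : Set G) = ⊤ :=
      Subgroup.centralizer_eq_top_iff_subset.mpr (by simp)
    rw [cdMeasure, hK, hC, Subgroup.card_bot, Subgroup.card_top, one_mul, hG]
  · exact .inr (.inr (by simpa using hab.symm))
  · have hK : Nat.card K = a := by simpa using hab.symm
    right; left
    rw [cdMeasure, Subgroup.card_centralizer_of_card_eq_prime hp hq hG hZ hK, hK]
  · have hK : K = ⊤ := Subgroup.eq_top_of_card_eq _ (hab.symm.trans hG.symm)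
    left
    rw [cdMeasure, hK, Subgroup.coe_top, Subgroup.centralizer_univ, hZ, Subgroup.card_bot,
      Subgroup.card_top, mul_one, hG]

/-- If `p < q` are primes and `G` is a non-abelian group of order `pq`, then `G` has a
unique subgroup `Q` of order `q` and `CD(G) = {Q}`. -/
theorem cd_nonabelian_pq (G : Type*) [Group G] [Finite G] (p q : ℕ) (hp : p.Prime)
    (hq : q.Prime) (hpq : p < q) (hG : Nat.card G = p * q)
    (hna : ¬ ∀ a b : G, a * b = b * a) :
    (∃! Q : Subgroup G, Nat.card Q = q) ∧
      ∀ Q : Subgroup G, Nat.card Q = q → cdLattice G = {Q} := by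
  have hle : ∀ H K : Subgroup G, Nat.card H = q → Nat.card K = q → K ≤ H := fun H K hH hK => by
    have hidx := H.card_mul_index
    rw [hH, hG, mul_comm] at hidx
    exact Subgroup.le_of_index_lt_card_prime hq hK
      (Nat.eq_of_mul_eq_mul_right hq.pos hidx ▸ hpq)
  have huniq : ∀ H K : Subgroup G, Nat.card H = q → Nat.card K = q → K = H := fun H K hH hK =>
    le_antisymm (hle H K hH hK) (hle K H hK hH)
  have hZ := Subgroup.center_eq_bot_of_card_eq_mul_prime hp hq hG hna
  have hmeas : ∀ Q : Subgroup G, Nat.card Q = q → cdMeasure G Q = q * q := fun Q hQ => by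
    rw [cdMeasure, Subgroup.card_centralizer_of_card_eq_prime hq hp (hG.trans (mul_comm p q)) hZ hQ,
      hQ]
  have hpq_lt : p * q < q * q := Nat.mul_lt_mul_of_pos_right hpq hq.pos
  have hpp_lt : p * p < q * q := Nat.mul_self_lt_mul_self hpq
  refine ⟨?_, fun Q hQ => ?_⟩
  · have := Fact.mk hq
    obtain ⟨x, hx⟩ := exists_prime_orderOf_dvd_card' (G := G) q (hG ▸ Dvd.intro_left p rfl)
    have hQ : Nat.card (Subgroup.zpowers x) = q := (Nat.card_zpowers x).trans hx
    exact ⟨_, hQ, fun K hK => huniq _ K hQ hK⟩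
  · ext K
    rw [Set.mem_singleton_iff]
    constructor
    · intro hK
      have hKQ := hK Q
      rw [hmeas Q hQ] at hKQ
      rcases cdMeasure_eq_or hp hq hG hZ K with h | h | h
      · omega
      · omega
      · exact huniq Q K hQ h
    · rintro rfl L
      rw [hmeas K hQ]
      rcases cdMeasure_eq_or hp hq hG hZ L with h | h | h
      · omega
      · omega
      · exact (hmeas L h).le
end
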